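/- arXiv:2603.29381 — 3 statements merged into one kernel-verified Lean document; each statement's English description precedes it below -/
import Mathlib

section
/- Let G be a finite connected simple graph. Then there exist a MAD tree T of G and a median vertex c of T such that there is no vertex c' ≠ c with N_G[c] strictly contained in N_G[c']. -/
open SimpleGraph

/-- The Wiener index of a graph: the sum of distances over all unordered pairs of
vertices (each unordered pair is counted twice in the double sum, hence the division). -/
noncomputable def wiener {V : Type*} [Fintype V] (G : SimpleGraph V) : ℕ :=
  (∑ u : V, ∑ v : V, G.dist u v) / 2

/-- `T` is a spanning tree of `G`. -/
def IsSpanningTree {V : Type*} (G T : SimpleGraph V) : Prop :=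
  T ≤ G ∧ T.IsTree

/-- `T` is a MAD tree of `G`: a spanning tree minimizing the Wiener index among
all spanning trees of `G`. -/
def IsMADTree {V : Type*} [Fintype V] (G T : SimpleGraph V) : Prop :=
  IsSpanningTree G T ∧ ∀ T' : SimpleGraph V, IsSpanningTree G T' → wiener T ≤ wiener T'

/-- A module of `G`: every vertex outside `M` is adjacent to all vertices of `M`
or to none of them. -/
def IsModule {V : Type*} (G : SimpleGraph V) (M : Set V) : Prop :=
  ∀ x ∉ M, (∀ v ∈ M, G.Adj x v) ∨ (∀ v ∈ M, ¬ G.Adj x v)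

/-- A modular partition `M_1, …, M_k` (with `k ≥ 2`) of the vertex set of `G`
into (nonempty, pairwise disjoint, covering) modules. -/
def IsModularPartition {V : Type*} (G : SimpleGraph V) {k : ℕ} (M : Fin k → Set V) : Prop :=
  2 ≤ k ∧ (∀ j, (M j).Nonempty) ∧ (∀ j, IsModule G (M j)) ∧
    (Pairwise fun j j' => Disjoint (M j) (M j')) ∧ (⋃ j, M j) = Set.univ

/-- `r` is a root of the spanning tree `T` of `G`: every path in `T` starting at `r`
is an induced path in `G`, i.e. any two vertices of the path that are adjacent in `G`
are consecutive on the path. -/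
def IsRoot {V : Type*} (G T : SimpleGraph V) (r : V) : Prop :=
  ∀ ⦃v : V⦄ (p : T.Walk r v), p.IsPath →
    ∀ x ∈ p.support, ∀ y ∈ p.support, G.Adj x y → s(x, y) ∈ p.edges

/-- `T` is a poly-star with respect to the partition `M`: every part contains at most
one vertex of degree at least 2 in `T`. -/
def IsPolyStar {V : Type*} (T : SimpleGraph V) {k : ℕ} (M : Fin k → Set V) : Prop :=
  ∀ j : Fin k, ∀ u ∈ M j, ∀ v ∈ M j,
    2 ≤ (T.neighborSet u).ncard → 2 ≤ (T.neighborSet v).ncard → u = v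

lemma aux_tree_of_image {V : Type*} [Fintype V] {T H : SimpleGraph V} (hT : T.IsTree)
    (hH : H.Connected) (g : Sym2 V → Sym2 V) (h : H.edgeSet ⊆ g '' T.edgeSet) : H.IsTree := by
  classical
  rw [isTree_iff_connected_and_card] at hT ⊢
  refine ⟨hH, le_antisymm ?_ hH.card_vert_le_card_edgeSet_add_one⟩
  rw [← hT.2]
  have h1 : H.edgeSet.ncard ≤ (g '' T.edgeSet).ncard := Set.ncard_le_ncard h (Set.toFinite _)
  have h2 : (g '' T.edgeSet).ncard ≤ T.edgeSet.ncard := Set.ncard_image_le (Set.toFinite _)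
  rw [Nat.card_coe_set_eq, Nat.card_coe_set_eq]
  omega

lemma aux_dist_eq {V : Type*} {T H : SimpleGraph V} (hT : T.IsTree) (hle : H ≤ T) {u v : V}
    (hr : H.Reachable u v) : H.dist u v = T.dist u v := by
  obtain ⟨p, hp⟩ := hr.exists_isPath
  obtain ⟨q, hq, hql⟩ := hT.connected.exists_path_of_dist u v
  have h1 : (p.mapLe hle).IsPath := by simpa using hp
  have := (hT.existsUnique_path u v).unique h1 hq
  have h2 : p.length = T.dist u v := by
    rw [← hql, ← this]; simp
  apply le_antisymm
  · rw [← h2]; exact dist_le p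
  · exact Reachable.dist_anti hle hr

lemma aux_edge {V : Type*} {T : SimpleGraph V} (hT : T.IsTree) {p q : V} (hpq : T.Adj p q) :
    ∃ S : V → Prop, S q ∧ ¬ S p ∧
      (∀ u v, S u → ¬ S v → T.dist u v = T.dist u q + 1 + T.dist p v) ∧
      (∀ u v, (S u ↔ S v) → (T.deleteEdges {s(p,q)}).Reachable u v) := by
  have hb : ¬ (T.deleteEdges {s(p,q)}).Reachable p q :=
    isAcyclic_iff_forall_adj_isBridge.1 hT.isAcyclic hpq
  set H := T.deleteEdges {s(p,q)} with hH
  have hadj : ∀ u v, T.Adj u v → (u = p ∧ v = q) ∨ (u = q ∧ v = p) ∨ H.Adj u v := by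
    intro u v h
    by_cases h' : s(u,v) = s(p,q)
    · rw [Sym2.eq_iff] at h'; tauto
    · right; right; rw [hH, deleteEdges_adj]; exact ⟨h, h'⟩
  have hcov : ∀ v, H.Reachable q v ∨ H.Reachable p v := by
    intro v
    obtain ⟨w⟩ := hT.connected v q
    induction w with
    | nil => left; rfl
    | @cons a b _ h w ih =>
      rcases hadj _ _ h with ⟨rfl, rfl⟩ | ⟨rfl, rfl⟩ | h
      · right; rfl
      · left; rfl
      · rcases ih hpq hb (by rfl) (hadj) with ih | ih
        · exact Or.inl (ih.trans h.symm.reachable)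
        · exact Or.inr (ih.trans h.symm.reachable)
  refine ⟨fun v => H.Reachable q v, by rfl, fun h => hb h.symm, ?_, ?_⟩
  · intro u v hu hv
    apply le_antisymm
    · have h1 := hT.connected.dist_triangle (u := u) (v := q) (w := v)
      have h2 := hT.connected.dist_triangle (u := q) (v := p) (w := v)
      have h3 : T.dist q p = 1 := dist_eq_one_iff_adj.2 hpq.symm
      omega
    · have key : ∀ {u v : V} (w : T.Walk u v), H.Reachable q u → ¬ H.Reachable q v →
          T.dist u q + 1 + T.dist p v ≤ w.length := by
        intro u v w
        induction w with
        | nil => intro h h'; exact absurd h h'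
        | @cons a b z h w ih =>
          intro hu hv
          rw [Walk.length_cons]
          rcases hadj _ _ h with ⟨rfl, rfl⟩ | ⟨rfl, rfl⟩ | h2
          · exact absurd hu.symm hb
          · have := dist_le w
            simp only [dist_self]; omega
          · have := ih (hu.trans h2.reachable) hv
            have h1 := hT.connected.dist_triangle (u := a) (v := b) (w := q)
            have h3 : T.dist a b = 1 := dist_eq_one_iff_adj.2 h
            omega
      obtain ⟨w, hw⟩ := hT.connected.exists_walk_length_eq_dist u v
      rw [← hw]; exact key w hu hv
  · intro u v huv
    by_cases hu : H.Reachable q u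
    · exact hu.symm.trans (huv.1 hu)
    · have hv : ¬ H.Reachable q v := fun h => hu (huv.2 h)
      exact ((hcov u).resolve_left hu).symm.trans ((hcov v).resolve_left hv)

/-- Step 1: a vertex `q` adjacent in `G` to the median `c` is adjacent to it in a MAD tree. -/
lemma aux_step1 {V : Type*} [Fintype V] {G T : SimpleGraph V} (hT : IsMADTree G T) {c q : V}
    (hc : ∀ v : V, (∑ u : V, T.dist u c) ≤ (∑ u : V, T.dist u v)) (hcq : G.Adj c q) :
    T.Adj c q := by
  classical
  by_contra hn
  obtain ⟨⟨hle, hTt⟩, hmin⟩ := hT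
  have hconn := hTt.connected
  obtain ⟨w, hw⟩ := hconn.exists_walk_length_eq_dist q c
  cases w with
  | nil => exact hcq.ne rfl
  | @cons _ p _ h w =>
  rw [Walk.length_cons] at hw
  have hpc : T.dist p c + 1 ≤ T.dist q c := by have := dist_le w; omega
  have hpne : p ≠ c := by rintro rfl; exact hn h.symm
  have hpos : 1 ≤ T.dist p c := hconn.pos_dist_of_ne hpne
  obtain ⟨S, hSq, hSp, hd, hr⟩ := aux_edge hTt h.symm
  have hSc : ¬ S c := by
    intro hSc
    have := hd c p hSc hSp
    rw [dist_self, dist_comm, dist_comm (u := c)] at this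
    omega
  set H := T.deleteEdges {s(p,q)} with hH
  have hHT : H ≤ T := deleteEdges_le _
  set g : Sym2 V → Sym2 V := fun e => if e = s(p,q) then s(c,q) else e with hg
  set T' := fromEdgeSet (g '' T.edgeSet) with hT'
  have hHT' : H ≤ T' := by
    intro a b hab
    rw [hH, deleteEdges_adj] at hab
    rw [hT', fromEdgeSet_adj]
    exact ⟨⟨s(a,b), hab.1, if_neg hab.2⟩, hab.1.ne⟩
  have hcq' : T'.Adj c q := by
    rw [hT', fromEdgeSet_adj]
    exact ⟨⟨s(p,q), h.symm, if_pos rfl⟩, hcq.ne⟩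
  have hrq : ∀ v, T'.Reachable v q := by
    intro v
    by_cases hv : S v
    · exact (hr v q (by simp [hv, hSq])).mono hHT'
    · exact ((hr v c (by simp [hv, hSc])).mono hHT').trans hcq'.reachable
  have hconn' : T'.Connected :=
    { preconnected := fun u v => (hrq u).trans (hrq v).symm, nonempty := ⟨c⟩ }
  have htree' : T'.IsTree := by
    refine aux_tree_of_image hTt hconn' g ?_
    rw [hT', edgeSet_fromEdgeSet]; exact Set.sdiff_subset
  have hle' : T' ≤ G := by
    intro a b hab
    rw [hT', fromEdgeSet_adj] at hab
    obtain ⟨⟨e, he, hge⟩, -⟩ := hab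
    rw [hg] at hge
    dsimp only at hge
    split_ifs at hge
    · rw [← mem_edgeSet, ← hge]; exact hcq
    · rw [← mem_edgeSet, ← hge]; exact edgeSet_mono hle he
  have hw' := hmin T' ⟨hle', htree'⟩
  have hsame : ∀ u v, (S u ↔ S v) → T'.dist u v ≤ T.dist u v := by
    intro u v huv
    rw [← aux_dist_eq hTt hHT (hr u v huv)]
    exact Reachable.dist_anti hHT' (hr u v huv)
  have hcross : ∀ u v, S u → ¬ S v → (T'.dist u v : ℤ) ≤ T.dist u v + (T.dist v c - T.dist v p) := by
    intro u v hu hv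
    have h1 := hconn'.dist_triangle (u := u) (v := q) (w := v)
    have h2 := hconn'.dist_triangle (u := q) (v := c) (w := v)
    have h3 : T'.dist q c = 1 := dist_eq_one_iff_adj.2 hcq'.symm
    have h4 := hsame u q (by simp [hu, hSq])
    have h5 := hsame c v (by simp [hv, hSc])
    have h6 := hd u v hu hv
    rw [dist_comm (u := v), dist_comm (u := v)]
    omega
  set i : V → ℤ := fun u => if S u then 1 else 0 with hi
  set j : V → ℤ := fun v => if S v then 0 else (T.dist v c : ℤ) - T.dist v p with hj
  have hpt : ∀ u v, (T'.dist u v : ℤ) ≤ T.dist u v + (i u * j v + j u * i v) := by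
    intro u v
    by_cases hu : S u <;> by_cases hv : S v <;> simp only [hi, hj, hu, hv, if_true, if_false]
    · have := hsame u v (by simp [hu, hv]); simpa using this
    · have := hcross u v hu hv; simpa using this
    · have := hcross v u hv hu
      rw [dist_comm, T.dist_comm (u := v) (v := u)] at this; simpa using this
    · have := hsame u v (by simp [hu, hv]); simpa using this
  have hsum : (∑ u, ∑ v, (T'.dist u v : ℤ)) ≤
      (∑ u, ∑ v, (T.dist u v : ℤ)) + 2 * ((∑ u, i u) * ∑ v, j v) := by
    calc _ ≤ ∑ u, ∑ v, ((T.dist u v : ℤ) + (i u * j v + j u * i v)) :=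
          Finset.sum_le_sum fun u _ => Finset.sum_le_sum fun v _ => hpt u v
      _ = _ := by
          simp only [Finset.sum_add_distrib, ← Finset.sum_mul_sum]; ring
  have hpt2 : ∀ v, (T.dist v c : ℤ) - T.dist v p = j v + T.dist p c * i v := by
    intro v
    by_cases hv : S v
    · simp only [hi, hj, hv, if_true]
      have h1 := hd v c hv hSc
      have h2 := hd v p hv hSp
      rw [dist_self] at h2
      rw [h1, h2]; push_cast; ring
    · simp [hi, hj, hv]
  have hmed : (∑ v, (T.dist v c : ℤ)) ≤ ∑ v, (T.dist v p : ℤ) := by exact_mod_cast hc p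
  have hs2 : (∑ v, (T.dist v c : ℤ)) - ∑ v, (T.dist v p : ℤ) = ∑ v, j v + T.dist p c * ∑ v, i v := by
    rw [← Finset.sum_sub_distrib, Finset.sum_congr rfl fun v _ => hpt2 v,
      Finset.sum_add_distrib, Finset.mul_sum]
  have hI : 1 ≤ ∑ v, i v := by
    calc (1 : ℤ) = i q := by simp [hi, hSq]
      _ ≤ _ := Finset.single_le_sum (f := i) (fun v _ => by simp only [hi]; split_ifs <;> simp)
        (Finset.mem_univ q)
  have hJ : ∑ v, j v ≤ -1 := by
    have : (1 : ℤ) ≤ T.dist p c := by exact_mod_cast hpos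
    nlinarith
  have hfin : (∑ u, ∑ v, (T'.dist u v : ℤ)) + 2 ≤ (∑ u, ∑ v, (T.dist u v : ℤ)) := by nlinarith
  have hfin' : (∑ u, ∑ v, T'.dist u v) + 2 ≤ (∑ u, ∑ v, T.dist u v) := by exact_mod_cast hfin
  unfold wiener at hw'
  omega

/-- Step 2: if `c` is adjacent to `q` in the MAD tree `T` and `N[c] ⊆ N[q]`, then
either `c` or `q` is a leaf of `T`. -/
lemma aux_step2 {V : Type*} [Fintype V] {G T : SimpleGraph V} (hT : IsMADTree G T) {c q : V}
    (hcq : T.Adj c q) (hN : ∀ x, G.Adj c x → x ≠ q → G.Adj q x) :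
    (∀ x, T.Adj c x → x = q) ∨ (∀ x, T.Adj q x → x = c) := by
  classical
  obtain ⟨⟨hle, hTt⟩, hmin⟩ := hT
  have hconn := hTt.connected
  obtain ⟨S, hSq, hSc, hd, hr⟩ := aux_edge hTt hcq
  set f : V → V := fun x => if x = c then q else x with hf
  have hfc : f c = q := by simp [hf]
  have hfo : ∀ x, x ≠ c → f x = x := fun x hx => by simp [hf, hx]
  set g : Sym2 V → Sym2 V := fun e => if e = s(c,q) then s(c,q) else e.map f with hg
  set T' := fromEdgeSet (g '' T.edgeSet) with hT'
  have hcq' : T'.Adj c q := by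
    rw [hT', fromEdgeSet_adj]
    exact ⟨⟨s(c,q), hcq, if_pos rfl⟩, hcq.ne⟩
  have hstep : ∀ a b, T.Adj a b → f a = f b ∨ T'.Adj (f a) (f b) := by
    intro a b hab
    by_cases hfab : f a = f b
    · exact Or.inl hfab
    right
    rw [hT', fromEdgeSet_adj]
    refine ⟨⟨s(a,b), hab, ?_⟩, hfab⟩
    have : s(a,b) ≠ s(c,q) := by
      intro h
      rw [Sym2.eq_iff] at h
      rcases h with ⟨rfl, rfl⟩ | ⟨rfl, rfl⟩
      · exact hfab (by rw [hfc, hfo _ hcq.ne'])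
      · exact hfab (by rw [hfc, hfo _ hcq.ne'])
    simp only [hg]
    rw [if_neg this, Sym2.map_mk]
  have hwalk : ∀ {u v : V} (w : T.Walk u v), ∃ w' : T'.Walk (f u) (f v), w'.length ≤ w.length := by
    intro u v w
    induction w with
    | nil => exact ⟨Walk.nil, le_rfl⟩
    | @cons a b z h w ih =>
      obtain ⟨w', hw'⟩ := ih
      rcases hstep a b h with h | h
      · rw [h]; exact ⟨w', by rw [Walk.length_cons]; omega⟩
      · exact ⟨Walk.cons h w', by simp only [Walk.length_cons]; omega⟩
  have hdf : ∀ u v, T'.dist (f u) (f v) ≤ T.dist u v := by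
    intro u v
    obtain ⟨w, hw⟩ := hconn.exists_walk_length_eq_dist u v
    obtain ⟨w', hw'⟩ := hwalk w
    have := dist_le w'
    omega
  have hrq : ∀ v, T'.Reachable v q := by
    intro v
    by_cases hv : v = c
    · rw [hv]; exact hcq'.reachable
    · obtain ⟨w⟩ := hconn v q
      obtain ⟨w', -⟩ := hwalk w
      rw [hfo v hv, hfo q hcq.ne'] at w'
      exact ⟨w'⟩
  have hconn' : T'.Connected :=
    { preconnected := fun u v => (hrq u).trans (hrq v).symm, nonempty := ⟨c⟩ }
  have htree' : T'.IsTree := by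
    refine aux_tree_of_image hTt hconn' g ?_
    rw [hT', edgeSet_fromEdgeSet]; exact Set.sdiff_subset
  have hmapG : ∀ a b, T.Adj a b → s(a,b) ≠ s(c,q) → G.Adj (f a) (f b) := by
    intro a b hab hne
    have hG := hle hab
    by_cases ha : a = c
    · subst ha
      have hb : b ≠ q := by rintro rfl; exact hne rfl
      rw [hfc, hfo b hab.ne']
      exact hN b hG hb
    · by_cases hb : b = c
      · subst hb
        have ha' : a ≠ q := by rintro rfl; exact hne Sym2.eq_swap
        rw [hfc, hfo a ha]
        exact (hN a hG.symm ha').symm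
      · rw [hfo a ha, hfo b hb]; exact hG
  have hle' : T' ≤ G := by
    intro a b hab
    rw [hT', fromEdgeSet_adj] at hab
    obtain ⟨⟨e, he, hge⟩, -⟩ := hab
    simp only [hg] at hge
    split_ifs at hge with hh
    · rw [← mem_edgeSet, ← hge]; exact hle hcq
    · rw [← mem_edgeSet, ← hge]
      induction e with
      | h x y => exact hmapG x y he hh
  have hw' := hmin T' ⟨hle', htree'⟩
  have h1cq : T'.dist c q = 1 := dist_eq_one_iff_adj.2 hcq'
  have hqS : ∀ v, v ≠ c → T'.dist q v ≤ T.dist q v := by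
    intro v hv
    have := hdf q v
    rwa [hfo v hv, hfo q hcq.ne'] at this
  have hqR : ∀ v, v ≠ c → T'.dist q v ≤ T.dist c v := by
    intro v hv
    have := hdf c v
    rwa [hfo v hv, hfc] at this
  have hSne : ∀ v, S v → v ≠ c := by rintro v hv rfl; exact hSc hv
  have hSA : ∀ u v, S u → ¬ S v → v ≠ c → (T'.dist u v : ℤ) ≤ T.dist u v - 1 := by
    intro u v hu hv hvc
    have h1 := hconn'.dist_triangle (u := u) (v := q) (w := v)
    have h2 := hqS u (hSne u hu)
    rw [dist_comm, T.dist_comm] at h2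
    have h3 := hqR v hvc
    have h4 := hd u v hu hv
    omega
  have hSC : ∀ u, S u → T'.dist u c ≤ T.dist u c := by
    intro u hu
    have h1 := hconn'.dist_triangle (u := u) (v := q) (w := c)
    have h2 := hqS u (hSne u hu)
    rw [dist_comm, T.dist_comm] at h2
    have h4 := hd u c hu hSc
    rw [dist_self] at h4
    rw [T'.dist_comm (u := q) (v := c)] at h1
    omega
  have hAC : ∀ u, u ≠ c → T'.dist u c ≤ T.dist u c + 1 := by
    intro u hu
    have h1 := hconn'.dist_triangle (u := u) (v := q) (w := c)
    have h2 := hqR u hu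
    rw [dist_comm, T.dist_comm] at h2
    rw [T'.dist_comm (u := q) (v := c)] at h1
    omega
  have hnn : ∀ u v, u ≠ c → v ≠ c → T'.dist u v ≤ T.dist u v := by
    intro u v hu hv
    have := hdf u v
    rwa [hfo u hu, hfo v hv] at this
  set s : V → ℤ := fun u => if S u then 1 else 0 with hs
  set a : V → ℤ := fun u => if S u then 0 else if u = c then 0 else 1 with ha
  set e : V → ℤ := fun u => if u = c then 1 else 0 with he
  have hpt : ∀ u v, (T'.dist u v : ℤ) ≤
      T.dist u v + ((e u * a v + a u * e v) - (a u * s v + s u * a v)) := by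
    intro u v
    by_cases huc : u = c
    · by_cases hvc : v = c
      · subst huc; subst hvc
        simp [hs, ha, he, hSc]
      · subst huc
        rw [dist_comm, T.dist_comm]
        by_cases hv : S v
        · have := hSC v hv
          simp [hs, ha, he, hSc, hv, hvc]; omega
        · have := hAC v hvc
          simp [hs, ha, he, hSc, hv, hvc]; omega
    · by_cases hvc : v = c
      · subst hvc
        by_cases hu : S u
        · have := hSC u hu
          simp [hs, ha, he, hSc, hu, huc]; omega
        · have := hAC u huc
          simp [hs, ha, he, hSc, hu, huc]; omega
      · by_cases hu : S u <;> by_cases hv : S v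
        · have := hnn u v huc hvc
          simp [hs, ha, he, hu, hv, huc, hvc]; omega
        · have := hSA u v hu hv hvc
          simp [hs, ha, he, hu, hv, huc, hvc]; omega
        · have := hSA v u hv hu huc
          rw [dist_comm, T.dist_comm] at this
          simp [hs, ha, he, hu, hv, huc, hvc]; omega
        · have := hnn u v huc hvc
          simp [hs, ha, he, hu, hv, huc, hvc]; omega
  have hsum : (∑ u, ∑ v, (T'.dist u v : ℤ)) ≤
      (∑ u, ∑ v, (T.dist u v : ℤ)) + 2 * ((∑ u, a u) * (∑ v, e v - ∑ v, s v)) := by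
    calc _ ≤ ∑ u, ∑ v, ((T.dist u v : ℤ) +
              ((e u * a v + a u * e v) - (a u * s v + s u * a v))) :=
          Finset.sum_le_sum fun u _ => Finset.sum_le_sum fun v _ => hpt u v
      _ = _ := by
          simp only [Finset.sum_add_distrib, Finset.sum_sub_distrib, ← Finset.sum_mul_sum]; ring
  have hE : ∑ v, e v = 1 := by simp [he]
  by_contra hcon
  push Not at hcon
  obtain ⟨⟨x, hx, hxq⟩, ⟨y, hy, hyc⟩⟩ := hcon
  have hSx : ¬ S x := by
    intro hSx
    have h1 := hd x c hSx hSc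
    rw [dist_self, dist_eq_one_iff_adj.2 hx.symm] at h1
    have := hconn.pos_dist_of_ne hxq
    omega
  have hSy : S y := by
    by_contra hSy
    have h1 := hd q y hSq hSy
    rw [dist_self, dist_eq_one_iff_adj.2 hy] at h1
    have := hconn.pos_dist_of_ne hyc.symm
    omega
  have hA : 1 ≤ ∑ v, a v := by
    calc (1 : ℤ) = a x := by simp [ha, hSx, hx.ne']
      _ ≤ _ := Finset.single_le_sum (f := a)
        (fun v _ => by simp only [ha]; split_ifs <;> simp) (Finset.mem_univ x)
  have hS2 : 2 ≤ ∑ v, s v := by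
    calc (2 : ℤ) = ∑ v ∈ {q, y}, s v := by
          rw [Finset.sum_pair hy.ne]; simp [hs, hSq, hSy]
      _ ≤ _ := Finset.sum_le_sum_of_subset_of_nonneg (Finset.subset_univ _)
        (fun v _ _ => by simp only [hs]; split_ifs <;> simp)
  have hfin : (∑ u, ∑ v, (T'.dist u v : ℤ)) + 2 ≤ (∑ u, ∑ v, (T.dist u v : ℤ)) := by nlinarith
  have hfin' : (∑ u, ∑ v, T'.dist u v) + 2 ≤ (∑ u, ∑ v, T.dist u v) := by exact_mod_cast hfin
  unfold wiener at hw'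
  omega

lemma aux_dist_hom {V W : Type*} {G : SimpleGraph V} {H : SimpleGraph W} (f : G →g H)
    (hG : G.Connected) (u v : V) : H.dist (f u) (f v) ≤ G.dist u v := by
  obtain ⟨w, hw⟩ := hG.exists_walk_length_eq_dist u v
  rw [← hw, ← Walk.length_map f]
  exact dist_le _

/-- A leaf of a tree is a median only if there are at most two vertices. -/
lemma aux_leaf {V : Type*} [Fintype V] {T : SimpleGraph V} (hT : T.IsTree) {c q : V}
    (hc : ∀ v : V, (∑ u : V, T.dist u c) ≤ (∑ u : V, T.dist u v)) (hcq : T.Adj c q)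
    (hl : ∀ x, T.Adj c x → x = q) (z : V) : z = c ∨ z = q := by
  classical
  by_contra hz
  push Not at hz
  have hlt : ∀ u, u ≠ c → T.dist u q + 1 ≤ T.dist u c := by
    intro u hu
    obtain ⟨w, hw⟩ := hT.connected.exists_walk_length_eq_dist c u
    cases w with
    | nil => exact absurd rfl hu
    | @cons _ p _ h w =>
      obtain rfl := hl p h
      have := dist_le w
      rw [Walk.length_cons] at hw
      rw [dist_comm, T.dist_comm (u := u)]
      omega
  have h1 := hlt z hz.1
  have h2 : T.dist c q = 1 := dist_eq_one_iff_adj.2 hcq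
  have h3 : ∑ u, (T.dist u q + ((if u = z then 1 else 0) + (if u = q then 1 else 0))) ≤
      ∑ u, (T.dist u c + (if u = c then 1 else 0)) := by
    apply Finset.sum_le_sum
    intro u _
    by_cases huc : u = c
    · subst huc
      simp [h2, hz.1.symm, hcq.ne]
    · have := hlt u huc
      have h4 : ¬ (u = z ∧ u = q) := by rintro ⟨rfl, h⟩; exact hz.2 h
      simp only [huc, if_false]
      split_ifs <;> first | omega | (exfalso; exact h4 ⟨by assumption, by assumption⟩)
  have := hc q
  simp [Finset.sum_add_distrib] at h3
  omega

theorem stmt10 {V : Type*} [Fintype V] (G : SimpleGraph V) (hG : G.Connected) :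
    ∃ (T : SimpleGraph V) (c : V), IsMADTree G T ∧
      (∀ v : V, (∑ u : V, T.dist u c) ≤ (∑ u : V, T.dist u v)) ∧
      ¬ ∃ c' : V, c' ≠ c ∧ insert c (G.neighborSet c) ⊂ insert c' (G.neighborSet c') := by
  classical
  have hne := hG.nonempty
  obtain ⟨T₀, hT₀, hmin₀⟩ := Set.exists_min_image {T | IsSpanningTree G T} wiener
    (Set.toFinite _) (by obtain ⟨T, h1, h2⟩ := hG.exists_isTree_le; exact ⟨T, h1, h2⟩)
  obtain ⟨c₀, -, hc₀⟩ := Set.exists_min_image (Set.univ : Set V) (fun v => ∑ u, T₀.dist u v)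
    (Set.toFinite _) Set.univ_nonempty
  obtain ⟨⟨T, c⟩, ⟨hT, hc⟩, hmax⟩ := Set.exists_max_image
    {x : SimpleGraph V × V | IsMADTree G x.1 ∧
      ∀ v : V, (∑ u : V, x.1.dist u x.2) ≤ (∑ u : V, x.1.dist u v)}
    (fun x => (insert x.2 (G.neighborSet x.2)).ncard) (Set.toFinite _)
    ⟨(T₀, c₀), ⟨hT₀, hmin₀⟩, fun v => hc₀ v (Set.mem_univ v)⟩
  dsimp only at hT hc hmax
  refine ⟨T, c, hT, hc, ?_⟩
  rintro ⟨q, hqc, hss⟩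
  have hcqG : G.Adj c q := by
    have := hss.1 (Set.mem_insert c _)
    rcases this with h | h
    · exact absurd h.symm hqc
    · exact G.adj_symm h
  have hN : ∀ x, G.Adj c x → x ≠ q → G.Adj q x := by
    intro x hx hxq
    exact (hss.1 (Set.mem_insert_of_mem _ hx)).resolve_left hxq
  have hcq := aux_step1 hT hc hcqG
  rcases aux_step2 hT hcq hN with hl | hl
  · have := aux_leaf hT.1.2 hc hcq hl
    apply hss.2
    intro z _
    rcases this z with rfl | rfl
    · exact Set.mem_insert _ _
    · exact Set.mem_insert_of_mem _ hcqG
  · skip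
    set σ := Equiv.swap c q with hσ
    set T' := T.map σ.toEmbedding with hT'
    let φ : T ≃g T' := Iso.map σ T
    have hdist : ∀ u v, T'.dist (σ u) (σ v) = T.dist u v := by
      intro u v
      have hconn := hT.1.2.connected
      have hconn' : T'.Connected := (φ.isTree_iff.1 hT.1.2).connected
      apply le_antisymm
      · exact aux_dist_hom φ.toHom hconn u v
      · have := aux_dist_hom φ.symm.toHom hconn' (φ u) (φ v)
        have h2 : T.dist u v ≤ T'.dist (φ u) (φ v) := by simpa using this
        exact h2
    have hrow : ∀ v, ∑ u, T'.dist u (σ v) = ∑ u, T.dist u v := by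
      intro v
      rw [← Equiv.sum_comp σ]
      exact Finset.sum_congr rfl fun u _ => hdist u v
    have hwien : wiener T' = wiener T := by
      unfold wiener
      congr 1
      rw [Finset.sum_comm, ← Equiv.sum_comp σ, Finset.sum_congr rfl fun v _ => hrow v,
        Finset.sum_comm]
    have hadj : ∀ a b, T.Adj a b → G.Adj (σ a) (σ b) := by
      intro a b hab
      have key : ∀ b, T.Adj c b → G.Adj (σ c) (σ b) := by
        intro b hb
        by_cases hbq : b = q
        · subst hbq; simpa [hσ] using hcqG.symm
        · rw [hσ, Equiv.swap_apply_left, Equiv.swap_apply_of_ne_of_ne hb.ne' hbq]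
          exact hN b (hT.1.1 hb) hbq
      by_cases ha : a = c
      · subst ha; exact key b hab
      by_cases hb : b = c
      · subst hb; exact (key a hab.symm).symm
      have haq : a ≠ q := by rintro rfl; exact hb (hl b hab)
      have hbq : b ≠ q := by rintro rfl; exact ha (hl a hab.symm)
      rw [hσ, Equiv.swap_apply_of_ne_of_ne ha haq, Equiv.swap_apply_of_ne_of_ne hb hbq]
      exact hT.1.1 hab
    have hle' : T' ≤ G := by
      rw [hT', map_le_iff_le_comap]
      intro a b hab
      exact hadj a b hab
    have hMAD : IsMADTree G T' :=
      ⟨⟨hle', φ.isTree_iff.1 hT.1.2⟩, fun T'' h => hwien ▸ hT.2 T'' h⟩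
    have hσc : σ c = q := Equiv.swap_apply_left c q
    have hmed : ∀ v, ∑ u, T'.dist u q ≤ ∑ u, T'.dist u v := by
      intro v
      rw [← hσc, hrow, ← σ.apply_symm_apply v, hrow]
      exact hc _
    have := hmax (T', q) ⟨hMAD, hmed⟩
    dsimp only at this
    exact absurd this (not_le.2 (Set.ncard_lt_ncard hss (Set.toFinite _)))
end

section
/- Let G be a finite connected simple graph that is not a tree and let g be the girth of G (the length of a shortest cycle in G). Then every spanning tree T of G satisfies W(T) ≥ W(G) + g − 2. -/
open SimpleGraph

theorem stmt14 {V : Type*} [Fintype V] (G : SimpleGraph V) (hG : G.Connected)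
    (hnt : ¬ G.IsTree) (g : ℕ) (hg : G.girth = (g : ℕ∞))
    (T : SimpleGraph V) (hT : IsSpanningTree G T) :
    (wiener G : ℤ) + (g : ℤ) - 2 ≤ (wiener T : ℤ) := by
  classical
  obtain ⟨hle, htree⟩ := hT
  have hne : ∃ u v, G.Adj u v ∧ ¬ T.Adj u v := by
    by_contra! h
    apply hnt
    have : G = T := le_antisymm (fun u v huv => h u v huv) hle
    rw [this]; exact htree
  obtain ⟨u, v, huv, hnuv⟩ := hne
  have hmono : ∀ a b, G.dist a b ≤ T.dist a b := by
    intro a b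
    obtain ⟨p, hp⟩ := htree.connected.exists_walk_length_eq_dist a b
    have := SimpleGraph.dist_le (p.mapLe hle)
    simpa [hp] using this
  obtain ⟨p, hpp, hp⟩ := htree.connected.exists_path_of_dist v u
  have hcyc : (Walk.cons huv (p.mapLe hle)).IsCycle := by
    rw [Walk.cons_isCycle_iff]
    refine ⟨(Walk.mapLe_isPath hle).2 hpp, ?_⟩
    intro h
    rw [Walk.edges_mapLe_eq_edges] at h
    exact hnuv (p.adj_of_mem_edges h)
  have hgl : G.girth ≤ T.dist v u + 1 := by
    have := hcyc.girth_le_length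
    simpa [hp] using this
  have hgg : G.girth = g := by exact_mod_cast hg
  have h1 : G.dist u v = 1 := SimpleGraph.dist_eq_one_iff_adj.2 huv
  have h1' : G.dist v u = 1 := SimpleGraph.dist_eq_one_iff_adj.2 huv.symm
  have hsymm : T.dist u v = T.dist v u := SimpleGraph.dist_comm
  have huvne : u ≠ v := huv.ne
  have key : (∑ a : V, ∑ b : V, G.dist a b) + 2 * (T.dist v u - 1)
      ≤ ∑ a : V, ∑ b : V, T.dist a b := by
    have hpos : 1 ≤ T.dist v u := h1' ▸ hmono v u
    rw [← Fintype.sum_prod_type', ← Fintype.sum_prod_type']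
    have e : 2 * (T.dist v u - 1) = ∑ x : V × V,
        ((if x = (u, v) then (T.dist v u - 1) else 0)
          + (if x = (v, u) then (T.dist v u - 1) else 0)) := by
      rw [Finset.sum_add_distrib]; simp; omega
    rw [e, ← Finset.sum_add_distrib]
    apply Finset.sum_le_sum
    rintro ⟨a, b⟩ -
    have := hmono a b
    by_cases ha : (a, b) = (u, v)
    · obtain ⟨rfl, rfl⟩ := Prod.mk.inj ha
      simp [huvne]; omega
    · by_cases hb : (a, b) = (v, u)
      · obtain ⟨rfl, rfl⟩ := Prod.mk.inj hb
        simp [huvne.symm]; omega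
      · simp only [if_neg ha, if_neg hb]; omega
  unfold wiener
  omega
end

section
/- Let T be a finite tree. For an edge uv ∈ E(T), let T^u_{uv} and T^v_{uv} denote the two connected components of T − uv containing u and v, respectively, and set w_T(uv) := |V(T^u_{uv})| · |V(T^v_{uv})|. Then the Wiener index of T satisfies W(T) = Σ_{uv ∈ E(T)} w_T(uv). -/
open SimpleGraph

/-- For an edge `e = s(u,v)` of a tree `T`, the product
`w_T(uv) = |V(T^u_{uv})| * |V(T^v_{uv})|` of the sizes of the two connected
components of `T - uv` containing `u` and `v`, respectively. -/
noncomputable def edgeWeight {V : Type*} (T : SimpleGraph V) (e : Sym2 V) : ℕ :=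
  Sym2.lift
    ⟨fun u v =>
      {x | (T.deleteEdges {s(u, v)}).Reachable u x}.ncard *
        {x | (T.deleteEdges {s(u, v)}).Reachable v x}.ncard,
      fun u v => by dsimp only; rw [Sym2.eq_swap]; exact Nat.mul_comm _ _⟩ e


lemma aux_dist {V : Type*} [Fintype V] [DecidableEq V]
    (T : SimpleGraph V) [DecidableRel T.Adj] (hT : T.IsTree) (u v : V) :
    T.dist u v = ∑ e ∈ T.edgeFinset,
      (@ite ℕ ((T.deleteEdges {e}).Reachable u v) (Classical.propDecidable _) 0 1) := by
  classical
  obtain ⟨p, hp, hl⟩ := hT.connected.exists_path_of_dist u v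
  have key : ∀ e, e ∈ p.edges ↔ ¬ (T.deleteEdges {e}).Reachable u v := by
    intro e
    constructor
    · intro he hr
      obtain ⟨q, hq⟩ := hr.exists_isPath
      have h1 : (q.mapLe (T.deleteEdges_le {e})).IsPath := hq.mapLe _
      have h2 := (hT.existsUnique_path u v).unique hp h1
      rw [h2, Walk.edges_mapLe_eq_edges] at he
      have := q.edges_subset_edgeSet he
      simp [edgeSet_deleteEdges] at this
    · intro hr
      by_contra he
      exact hr ⟨p.toDeleteEdge e he⟩
  rw [← hl, ← Walk.length_edges, ← List.toFinset_card_of_nodup hp.isTrail.edges_nodup,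
    Finset.card_eq_sum_ones]
  rw [← Finset.sum_subset (s₁ := p.edges.toFinset) (s₂ := T.edgeFinset)]
  · apply Finset.sum_congr rfl
    intro e he
    rw [if_neg ((key e).1 (by simpa using he))]
  · intro e he
    have := p.edges_subset_edgeSet (by simpa using he : e ∈ p.edges)
    simpa using this
  · intro e _ he
    rw [if_pos]
    by_contra h
    exact he (by simpa using (key e).2 h)

lemma aux_cover {V : Type*} (T : SimpleGraph V) (a b : V) {x y : V} (w : T.Walk x y)
    (h : (T.deleteEdges {s(a, b)}).Reachable a x ∨ (T.deleteEdges {s(a, b)}).Reachable b x) :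
    (T.deleteEdges {s(a, b)}).Reachable a y ∨ (T.deleteEdges {s(a, b)}).Reachable b y := by
  induction w with
  | nil => exact h
  | @cons x z y hxz w ih =>
    apply ih
    by_cases he : s(x, z) = s(a, b)
    · rcases Sym2.eq_iff.1 he with ⟨_, rfl⟩ | ⟨_, rfl⟩
      · exact Or.inr (Reachable.refl _)
      · exact Or.inl (Reachable.refl _)
    · have : (T.deleteEdges {s(a, b)}).Adj x z := by
        rw [deleteEdges_adj]; exact ⟨hxz, by simpa using he⟩
      exact h.imp (fun h => h.trans this.reachable) (fun h => h.trans this.reachable)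

lemma aux_count {V : Type*} [Fintype V] [DecidableEq V]
    (T : SimpleGraph V) (hT : T.IsTree) (e : Sym2 V) (he : e ∈ T.edgeSet) :
    ∑ u : V, ∑ v : V,
      (@ite ℕ ((T.deleteEdges {e}).Reachable u v) (Classical.propDecidable _) 0 1)
      = 2 * edgeWeight T e := by
  classical
  induction e using Sym2.ind with | _ a b =>
  have hbr : ¬ (T.deleteEdges {s(a, b)}).Reachable a b := by
    have := isAcyclic_iff_forall_isBridge.1 hT.isAcyclic he
    simpa [isBridge_iff] using this
  have hcov : ∀ x, (T.deleteEdges {s(a, b)}).Reachable a x ∨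
      (T.deleteEdges {s(a, b)}).Reachable b x := fun x =>
    aux_cover T a b (hT.connected.preconnected a x).some (Or.inl (Reachable.refl _))
  simp only [edgeWeight, Sym2.lift_mk]
  have hs : ∀ {x y}, (T.deleteEdges {s(a, b)}).Reachable x y →
      (T.deleteEdges {s(a, b)}).Reachable y x := fun h => Reachable.symm h
  have ht : ∀ {x y z}, (T.deleteEdges {s(a, b)}).Reachable x y →
      (T.deleteEdges {s(a, b)}).Reachable y z →
      (T.deleteEdges {s(a, b)}).Reachable x z := fun h h' => Reachable.trans h h'
  generalize (T.deleteEdges {s(a, b)}).Reachable = R at *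
  have hA : ∀ c, {x | R c x}.ncard = ∑ x : V, if R c x then 1 else 0 := by
    intro c
    rw [Set.ncard_eq_toFinset_card', Finset.card_eq_sum_ones, ← Finset.sum_filter]
    congr 1
    ext; simp
  have hpt : ∀ u v, (if R u v then 0 else 1) =
      (if R a u then 1 else 0) * (if R b v then 1 else 0) +
      (if R b u then 1 else 0) * (if R a v then 1 else 0) := by
    intro u v
    have hn : ∀ x, R a x → ¬ R b x := fun x h h' => hbr (ht h (hs h'))
    rcases hcov u with hu | hu <;> rcases hcov v with hv | hv
    · simp [hu, hv, hn _ hu, hn _ hv, ht (hs hu) hv]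
    · have h1 : ¬ R a v := fun h => hn _ h hv
      have : ¬ R u v := fun h => h1 (ht hu h)
      simp [hu, hv, this, h1]
    · have h1 : ¬ R a u := fun h => hn _ h hu
      have : ¬ R u v := fun h => hn _ hv (ht hu h)
      simp [hu, hv, this, h1]
    · have h1 : ¬ R a u := fun h => hn _ h hu
      have h2 : ¬ R a v := fun h => hn _ h hv
      simp [hu, hv, h1, h2, ht (hs hu) hv]
  rw [hA, hA]
  simp only [hpt, Finset.sum_add_distrib]
  rw [← Finset.sum_mul_sum, ← Finset.sum_mul_sum]
  ring

theorem stmt17 {V : Type*} [Fintype V] [DecidableEq V]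
    (T : SimpleGraph V) [DecidableRel T.Adj] (hT : T.IsTree) :
    wiener T = ∑ e ∈ T.edgeFinset, edgeWeight T e := by
  have h : ∑ u : V, ∑ v : V, T.dist u v = 2 * ∑ e ∈ T.edgeFinset, edgeWeight T e := by
    simp only [aux_dist T hT]
    rw [Finset.mul_sum]
    simp_rw [Finset.sum_comm (s := Finset.univ) (t := T.edgeFinset)]
    exact Finset.sum_congr rfl fun e he => aux_count T hT e (by simpa using he)
  rw [wiener, h]
  simp
end
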